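/- arXiv:1003.0947 — 7 statements merged into one kernel-verified Lean document; each statement's English description precedes it below -/
import Mathlib

section
/- Let K and Γ be nonempty compact subsets of ℝ³ with d₀ := inf{|x−y| : x ∈ K, y ∈ Γ} > 0. Let M = {(x,y) ∈ K×Γ : |x−y| = d₀}, and for δ > 0 let W_δ = ⋃_{(x₀,y₀)∈M} (K ∩ B_δ(x₀)) × (Γ ∩ B_δ(y₀)) × (Γ ∩ B_δ(y₀)). Then for every ε > 0 there exists δ₁ > 0 such that for all (x,y,y') ∈ W_{δ₁}: ((x−y)/|x−y|)·((x−y')/|x−y'|) ≥ 1−ε, |x−y| ≤ d₀+ε, and |x−y'| ≤ d₀+ε. -/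
open MeasureTheory Filter Metric
open scoped RealInnerProductSpace Topology

/-- The inner product of the normalizations of `u` and `v` is close to `1` when `u - v` is small
compared with `u` and `v`. -/
lemma one_sub_norm_sub_sq_div_le_inner_normalized {E : Type*} [NormedAddCommGroup E]
    [InnerProductSpace ℝ E] {u v : E} (hu : 0 < ‖u‖) (hv : 0 < ‖v‖) :
    1 - ‖u - v‖ ^ 2 / (2 * (‖u‖ * ‖v‖)) ≤ ⟪‖u‖⁻¹ • u, ‖v‖⁻¹ • v⟫ := by
  rw [real_inner_smul_left, real_inner_smul_right, norm_sub_sq_real]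
  have h : ‖u‖⁻¹ * (‖v‖⁻¹ * ⟪u, v⟫) -
      (1 - (‖u‖ ^ 2 - 2 * ⟪u, v⟫ + ‖v‖ ^ 2) / (2 * (‖u‖ * ‖v‖))) =
      (‖u‖ - ‖v‖) ^ 2 / (2 * (‖u‖ * ‖v‖)) := by
    field_simp
    ring
  have h' : 0 ≤ (‖u‖ - ‖v‖) ^ 2 / (2 * (‖u‖ * ‖v‖)) := by positivity
  linarith

/-- Claim 1 of the Appendix: near the set `M` of closest pairs, the normalized
directions almost coincide and the distances are close to `d₀`. -/
theorem claim1
    (K Γ : Set (EuclideanSpace ℝ (Fin 3)))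
    (hKc : IsCompact K) (hKne : K.Nonempty)
    (hΓc : IsCompact Γ) (hΓne : Γ.Nonempty)
    (d₀ : ℝ)
    (hd₀ : d₀ = sInf {r : ℝ | ∃ x ∈ K, ∃ y ∈ Γ, r = dist x y})
    (hd₀pos : 0 < d₀)
    (M : Set (EuclideanSpace ℝ (Fin 3) × EuclideanSpace ℝ (Fin 3)))
    (hM : M = {p | p.1 ∈ K ∧ p.2 ∈ Γ ∧ dist p.1 p.2 = d₀})
    (W : ℝ → Set (EuclideanSpace ℝ (Fin 3) × EuclideanSpace ℝ (Fin 3) × EuclideanSpace ℝ (Fin 3)))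
    (hW : ∀ δ : ℝ, W δ = ⋃ p ∈ M,
      (K ∩ ball p.1 δ) ×ˢ ((Γ ∩ ball p.2 δ) ×ˢ (Γ ∩ ball p.2 δ))) :
    ∀ ε > 0, ∃ δ₁ > 0, ∀ q ∈ W δ₁,
      1 - ε ≤ ⟪‖q.1 - q.2.1‖⁻¹ • (q.1 - q.2.1), ‖q.1 - q.2.2‖⁻¹ • (q.1 - q.2.2)⟫ ∧
      dist q.1 q.2.1 ≤ d₀ + ε ∧ dist q.1 q.2.2 ≤ d₀ + ε := by
  intro ε hε
  obtain ⟨δ, hδ, hδε, hδd, hδεd⟩ : ∃ δ > 0, 2 * δ ≤ ε ∧ 8 * δ ≤ d₀ ∧ δ ≤ ε * d₀ := by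
    refine ⟨min (ε / 2) (min (d₀ / 8) (ε * d₀)), by positivity, ?_, ?_, ?_⟩
    · linarith [min_le_left (ε / 2) (min (d₀ / 8) (ε * d₀))]
    · linarith [(min_le_right (ε / 2) _).trans (min_le_left (d₀ / 8) (ε * d₀))]
    · exact (min_le_right _ _).trans (min_le_right _ _)
  refine ⟨δ, hδ, ?_⟩
  rintro ⟨x, y, y'⟩ hq
  simp only [hW, hM, Set.mem_iUnion, Set.mem_prod, Set.mem_inter_iff, mem_ball,
    Set.mem_ofPred_eq] at hq
  obtain ⟨⟨x₀, y₀⟩, ⟨-, -, h₀⟩, ⟨-, hx⟩, ⟨-, hy⟩, -, hy'⟩ := hq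
  dsimp only at h₀ hx hy hy' ⊢
  have upper : ∀ z, dist z y₀ < δ → dist x z ≤ d₀ + 2 * δ := fun z hz ↦ by
    linarith [dist_triangle4 x x₀ y₀ z, dist_comm z y₀]
  have lower : ∀ z, dist z y₀ < δ → d₀ / 2 ≤ ‖x - z‖ := fun z hz ↦ by
    rw [← dist_eq_norm]
    linarith [dist_triangle4 x₀ x z y₀, dist_comm x x₀]
  refine ⟨?_, (upper y hy).trans (by linarith), (upper y' hy').trans (by linarith)⟩
  have ha := lower y hy
  have hb := lower y' hy'
  have hsub : ‖(x - y) - (x - y')‖ ≤ 2 * δ := by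
    rw [sub_sub_sub_cancel_left, ← dist_eq_norm]
    linarith [dist_triangle_right y' y y₀]
  refine le_trans ?_ (one_sub_norm_sub_sq_div_le_inner_normalized (by linarith) (by linarith))
  have hab : d₀ / 2 * (d₀ / 2) ≤ ‖x - y‖ * ‖x - y'‖ := by gcongr
  have hpos : 0 < ‖x - y‖ * ‖x - y'‖ := lt_of_lt_of_le (by positivity) hab
  have hsq : ‖(x - y) - (x - y')‖ ^ 2 ≤ (2 * δ) ^ 2 := by gcongr
  have hδsq : 8 * δ * δ ≤ d₀ * (ε * d₀) := by gcongr
  have hεab := mul_le_mul_of_nonneg_left hab hε.le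
  apply sub_le_sub_left
  rw [div_le_iff₀ (by positivity)]
  linarith
end

section
/- Let K and Γ be nonempty compact subsets of ℝ³ with d₀ := inf{|x−y| : x ∈ K, y ∈ Γ} > 0. Let M = {(x,y) ∈ K×Γ : |x−y| = d₀}, and for δ > 0 let W_δ = ⋃_{(x₀,y₀)∈M} (K ∩ B_δ(x₀)) × (Γ ∩ B_δ(y₀)) × (Γ ∩ B_δ(y₀)). Assume nearest points are unique: whenever x ∈ K and y, y' ∈ Γ satisfy |x−y| = |x−y'| = d₀, then y = y'. Then for every δ₁ > 0 there exists δ₂ > 0 such that every (x,y,y') ∈ K×Γ×Γ with (x,y,y') ∉ W_{δ₁} satisfies |x−y| + |x−y'| ≥ 2d₀ + δ₂. -/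
open MeasureTheory Filter Metric
open scoped RealInnerProductSpace Topology

/-- Claim 2 of the Appendix: away from the neighbourhood `W_{δ₁}` of the set of
closest configurations, the sum of distances exceeds `2d₀` by a uniform margin. -/
theorem claim2
    (K Γ : Set (EuclideanSpace ℝ (Fin 3)))
    (hKc : IsCompact K) (hKne : K.Nonempty)
    (hΓc : IsCompact Γ) (hΓne : Γ.Nonempty)
    (d₀ : ℝ)
    (hd₀ : d₀ = sInf {r : ℝ | ∃ x ∈ K, ∃ y ∈ Γ, r = dist x y})
    (hd₀pos : 0 < d₀)
    (M : Set (EuclideanSpace ℝ (Fin 3) × EuclideanSpace ℝ (Fin 3)))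
    (hM : M = {p | p.1 ∈ K ∧ p.2 ∈ Γ ∧ dist p.1 p.2 = d₀})
    (W : ℝ → Set (EuclideanSpace ℝ (Fin 3) × EuclideanSpace ℝ (Fin 3) × EuclideanSpace ℝ (Fin 3)))
    (hW : ∀ δ : ℝ, W δ = ⋃ p ∈ M,
      (K ∩ ball p.1 δ) ×ˢ ((Γ ∩ ball p.2 δ) ×ˢ (Γ ∩ ball p.2 δ)))
    (huniq : ∀ x ∈ K, ∀ y ∈ Γ, ∀ y' ∈ Γ,
      dist x y = d₀ → dist x y' = d₀ → y = y') :
    ∀ δ₁ > 0, ∃ δ₂ > 0, ∀ q ∈ (K ×ˢ (Γ ×ˢ Γ)) \ W δ₁,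
      2 * d₀ + δ₂ ≤ dist q.1 q.2.1 + dist q.1 q.2.2 := by
  intro δ₁ hδ₁
  have hle : ∀ x ∈ K, ∀ y ∈ Γ, d₀ ≤ dist x y := by
    intro x hx y hy
    rw [hd₀]
    refine csInf_le ⟨0, ?_⟩ ⟨x, hx, y, hy, rfl⟩
    rintro r ⟨a, -, b, -, rfl⟩
    exact dist_nonneg
  set U : Set (EuclideanSpace ℝ (Fin 3) × EuclideanSpace ℝ (Fin 3) × EuclideanSpace ℝ (Fin 3)) :=
    ⋃ p ∈ M, ball p.1 δ₁ ×ˢ (ball p.2 δ₁ ×ˢ ball p.2 δ₁) with hU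
  have hUo : IsOpen U :=
    isOpen_biUnion fun p _ => isOpen_ball.prod (isOpen_ball.prod isOpen_ball)
  have hsub : (K ×ˢ (Γ ×ˢ Γ)) \ W δ₁ = (K ×ˢ (Γ ×ˢ Γ)) \ U := by
    ext ⟨x, y, z⟩
    simp only [hW, hU, Set.mem_sdiff, Set.mem_prod, Set.mem_iUnion, Set.mem_inter_iff]
    grind
  have hcomp : IsCompact ((K ×ˢ (Γ ×ˢ Γ)) \ W δ₁) :=
    hsub ▸ (hKc.prod (hΓc.prod hΓc)).diff hUo
  have hlt : ∀ q ∈ (K ×ˢ (Γ ×ˢ Γ)) \ W δ₁,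
      2 * d₀ < dist q.1 q.2.1 + dist q.1 q.2.2 := by
    rintro ⟨x, y, z⟩ ⟨⟨hx, hy, hz⟩, hq⟩
    dsimp only at hx hy hz ⊢
    have hxy := hle x hx y hy
    have hxz := hle x hx z hz
    by_contra! hsum
    have hy₀ : dist x y = d₀ := by linarith
    obtain rfl := huniq x hx y hy z hz hy₀ (by linarith)
    refine hq ?_
    rw [hW]
    have hmem : (x, y) ∈ M := by
      rw [hM]
      exact ⟨hx, hy, hy₀⟩
    have hyb := mem_ball_self (x := y) hδ₁
    exact Set.mem_biUnion hmem ⟨⟨hx, mem_ball_self hδ₁⟩, ⟨hy, hyb⟩, ⟨hy, hyb⟩⟩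
  obtain ⟨a, ha, hmin⟩ := hcomp.exists_forall_le' (by fun_prop) hlt
  exact ⟨a - 2 * d₀, by linarith, fun q hq => by linarith [hmin q hq]⟩
end

section
/- Let C > 0, δ₀ > 0, and let g : ℝ² → ℝ satisfy |g(σ)| ≤ C|σ| for all σ ∈ ℝ². Set E = {(σ,s) ∈ ℝ² × ℝ : s > g(σ) and |σ|² + s² < δ₀²}. Then liminf_{τ→∞} τ^{3/2} ∫_E e^{−2√τ √(|σ|²+s²)} dσ ds > 0. -/
open MeasureTheory Filter Metric
open scoped Topology

/-- The measure of a Euclidean disc of radius `r` times an interval of length `r`. -/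
lemma volume_real_ball_prod_Ioo (a : ℝ) {r : ℝ} (hr : 0 ≤ r) :
    volume.real (ball (0 : EuclideanSpace ℝ (Fin 2)) r ×ˢ Set.Ioo a (a + r)) = Real.pi * r ^ 3 := by
  rw [Measure.real, Measure.volume_eq_prod, Measure.prod_prod, ENNReal.toReal_mul,
    EuclideanSpace.volume_ball_fin_two, Real.volume_Ioo, add_sub_cancel_left, ENNReal.toReal_mul,
    ENNReal.toReal_pow, ENNReal.toReal_ofReal hr,
    ENNReal.toReal_ofReal Real.pi_nonneg]
  ring

/-- If `S` contains a measurable set `A` of finite measure on which `f` is at least `b`, then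
the integral of the nonnegative function `f` over `S` is at least `b` times the measure of `A`.
The set `S` need not be measurable. -/
lemma mul_measureReal_le_setIntegral {α : Type*} [MeasurableSpace α] {μ : Measure α}
    {A S : Set α} {f : α → ℝ} {b : ℝ} (hA : MeasurableSet A) (hμA : μ A ≠ ⊤) (hAS : A ⊆ S)
    (hf : IntegrableOn f S μ) (hf0 : ∀ x, 0 ≤ f x) (hb : ∀ x ∈ A, b ≤ f x) :
    b * μ.real A ≤ ∫ x in S, f x ∂μ :=
  calc b * μ.real A = ∫ _ in A, b ∂μ := by rw [setIntegral_const, smul_eq_mul, mul_comm]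
    _ ≤ ∫ x in A, f x ∂μ :=
      setIntegral_mono_on (integrableOn_const hμA) (hf.mono_set hAS) hA hb
    _ ≤ ∫ x in S, f x ∂μ :=
      setIntegral_mono_set hf (Eventually.of_forall hf0) hAS.eventuallyLE

/-- A point of the cylinder of radius `r` and height range `(C r, C r + r)` has squared norm
less than `((C + 2) r)²`. -/
lemma sq_add_sq_lt_of_mem_cylinder {C r x s : ℝ} (hC : 0 < C) (hx0 : 0 ≤ x) (hx : x < r)
    (hs : C * r < s) (hs' : s < C * r + r) : x ^ 2 + s ^ 2 < ((C + 2) * r) ^ 2 := by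
  have hr : 0 < r := hx0.trans_lt hx
  have hs0 : 0 < s := (mul_pos hC hr).trans hs
  calc x ^ 2 + s ^ 2 < r ^ 2 + (C * r + r) ^ 2 := by gcongr
    _ ≤ ((C + 2) * r) ^ 2 := by nlinarith [mul_pos hC (mul_pos hr hr), mul_pos hr hr]

/-- The exponential kernel is integrable on every set of bounded Euclidean norm. -/
lemma integrableOn_exp_kernel {R a : ℝ} (hR : 0 ≤ R) {S : Set (EuclideanSpace ℝ (Fin 2) × ℝ)}
    (hS : ∀ p ∈ S, ‖p.1‖ ^ 2 + p.2 ^ 2 < R ^ 2) :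
    IntegrableOn (fun p => Real.exp (a * Real.sqrt (‖p.1‖ ^ 2 + p.2 ^ 2))) S := by
  have hcont : Continuous fun p : EuclideanSpace ℝ (Fin 2) × ℝ =>
      Real.exp (a * Real.sqrt (‖p.1‖ ^ 2 + p.2 ^ 2)) := by fun_prop
  refine (hcont.continuousOn.integrableOn_compact
    ((isCompact_closedBall 0 R).prod (isCompact_closedBall 0 R))).mono_set fun p hp => ?_
  have h := hS p hp
  constructor <;> rw [mem_closedBall_zero_iff]
  · exact abs_le_of_sq_le_sq' (by nlinarith [sq_nonneg p.2]) hR |>.2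
  · exact abs_le_of_sq_le_sq (by nlinarith [sq_nonneg ‖p.1‖]) hR

/-- Claim 3 of the Appendix (flattened form): the local volume integral of the
exponential kernel over the region above the graph of `g` decays no faster
than `τ^{-3/2}`, i.e. `liminf_{τ→∞} τ^{3/2} ∫_E e^{-2√τ √(|σ|²+s²)} dσ ds > 0`. -/
theorem claim3
    (C δ₀ : ℝ) (hC : 0 < C) (hδ₀ : 0 < δ₀)
    (g : EuclideanSpace ℝ (Fin 2) → ℝ)
    (hg : ∀ σ, |g σ| ≤ C * ‖σ‖)
    (Eset : Set (EuclideanSpace ℝ (Fin 2) × ℝ))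
    (hE : Eset = {p | g p.1 < p.2 ∧ ‖p.1‖ ^ 2 + p.2 ^ 2 < δ₀ ^ 2}) :
    ∃ c > 0, ∀ᶠ τ : ℝ in atTop,
      c ≤ τ ^ ((3 : ℝ) / 2) *
        ∫ p in Eset, Real.exp (-2 * Real.sqrt τ * Real.sqrt (‖p.1‖ ^ 2 + p.2 ^ 2)) := by
  subst hE
  refine ⟨Real.exp (-2 * (C + 2)) * Real.pi, by positivity, ?_⟩
  filter_upwards [eventually_gt_atTop 0,
    Real.tendsto_sqrt_atTop.eventually_gt_atTop ((C + 2) / δ₀)] with τ hτ hτ'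
  obtain ⟨r, hr⟩ : ∃ r, r = (Real.sqrt τ)⁻¹ := ⟨_, rfl⟩
  have hsτ : 0 < Real.sqrt τ := Real.sqrt_pos.2 hτ
  have hr0 : 0 < r := hr ▸ inv_pos.2 hsτ
  have hrτ : Real.sqrt τ * r = 1 := hr ▸ mul_inv_cancel₀ hsτ.ne'
  have hrδ : (C + 2) * r < δ₀ := by
    rw [hr, ← div_eq_mul_inv, div_lt_comm₀ hsτ hδ₀]
    exact hτ'
  have hτpow : τ ^ ((3 : ℝ) / 2) = Real.sqrt τ ^ 3 := by
    rw [Real.sqrt_eq_rpow, ← Real.rpow_mul_natCast hτ.le]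
    norm_num
  have hnorm : ∀ p ∈ ball (0 : EuclideanSpace ℝ (Fin 2)) r ×ˢ Set.Ioo (C * r) (C * r + r),
      ‖p.1‖ ^ 2 + p.2 ^ 2 < ((C + 2) * r) ^ 2 := fun p hp =>
    sq_add_sq_lt_of_mem_cylinder hC (norm_nonneg _) (mem_ball_zero_iff.1 hp.1) hp.2.1 hp.2.2
  have hint := mul_measureReal_le_setIntegral (μ := volume) (b := Real.exp (-2 * (C + 2)))
    (A := ball (0 : EuclideanSpace ℝ (Fin 2)) r ×ˢ Set.Ioo (C * r) (C * r + r))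
    (S := {p | g p.1 < p.2 ∧ ‖p.1‖ ^ 2 + p.2 ^ 2 < δ₀ ^ 2})
    (f := fun p => Real.exp (-2 * Real.sqrt τ * Real.sqrt (‖p.1‖ ^ 2 + p.2 ^ 2)))
    (measurableSet_ball.prod measurableSet_Ioo)
    (isBounded_ball.prod (isBounded_Ioo _ _)).measure_lt_top.ne
    (fun p hp => by
      refine ⟨?_, (hnorm p hp).trans (by gcongr)⟩
      calc g p.1 ≤ C * ‖p.1‖ := (le_abs_self _).trans (hg _)
        _ ≤ C * r := by gcongr; exact (mem_ball_zero_iff.1 hp.1).le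
        _ < p.2 := hp.2.1)
    (integrableOn_exp_kernel hδ₀.le fun p hp => hp.2) (fun _ => (Real.exp_pos _).le)
    (fun p hp => by
      have hle : Real.sqrt (‖p.1‖ ^ 2 + p.2 ^ 2) ≤ (C + 2) * r :=
        Real.sqrt_le_iff.2 ⟨by positivity, (hnorm p hp).le⟩
      have hmul := mul_le_mul_of_nonneg_left hle hsτ.le
      have heq : Real.sqrt τ * ((C + 2) * r) = C + 2 := by rw [mul_left_comm, hrτ, mul_one]
      exact Real.exp_le_exp.2 (by linarith))
  rw [volume_real_ball_prod_Ioo _ hr0.le] at hint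
  calc Real.exp (-2 * (C + 2)) * Real.pi
      = Real.sqrt τ ^ 3 * (Real.exp (-2 * (C + 2)) * (Real.pi * r ^ 3)) := by
        have hcube : Real.sqrt τ ^ 3 * r ^ 3 = 1 := by rw [← mul_pow, hrτ, one_pow]
        linear_combination (-Real.exp (-2 * (C + 2)) * Real.pi) * hcube
    _ ≤ _ := by rw [hτpow]; gcongr
end

section
/- Let D ⊆ ℝ³ be a nonempty bounded open set and ω ∈ ℝ³ a unit vector. Assume there exist c ∈ ℝ³ and ρ > 0 such that the open ball B_ρ(c) ⊆ D and c·ω + ρ = h_D(ω). Then there exists μ₁ ∈ ℝ such that liminf_{τ→∞} τ^{μ₁} e^{−2√τ h_D(ω)} ∫_D e^{2√τ x·ω} dx > 0. -/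
open MeasureTheory Filter Metric
open scoped RealInnerProductSpace Topology

/-- The interior ball of radius `s ≤ ρ` tangent to `ball c ρ` at its extreme point in the unit
direction `ω` is contained in `ball c ρ`. -/
lemma ball_add_smul_subset_ball {E : Type*} [NormedAddCommGroup E] [NormedSpace ℝ E]
    (c ω : E) (hω : ‖ω‖ = 1) {s ρ : ℝ} (hs : s ≤ ρ) :
    ball (c + (ρ - s) • ω) s ⊆ ball c ρ := by
  apply ball_subset_ball'
  rw [dist_eq_norm, add_sub_cancel_left, norm_smul, hω, Real.norm_eq_abs,
    abs_of_nonneg (sub_nonneg.2 hs)]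
  linarith

/-- On the ball of radius `s` tangent to `ball c ρ` at its extreme point in the unit direction `ω`,
the linear functional `⟪·, ω⟫` is within `2 * s` of its supremum over `ball c ρ`. -/
lemma le_inner_of_mem_ball_add_smul {E : Type*} [NormedAddCommGroup E] [InnerProductSpace ℝ E]
    {c ω x : E} (hω : ‖ω‖ = 1) {s ρ : ℝ} (hx : x ∈ ball (c + (ρ - s) • ω) s) :
    ⟪c, ω⟫ + ρ - 2 * s ≤ ⟪x, ω⟫ := by
  have h := abs_real_inner_le_norm (x - (c + (ρ - s) • ω)) ω
  rw [hω, mul_one, inner_sub_left, inner_add_left, real_inner_smul_left,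
    real_inner_self_eq_norm_sq, hω] at h
  rw [mem_ball, dist_eq_norm] at hx
  linarith [(abs_le.1 h).1]

/-- A continuous function is integrable on a bounded set of a proper metric space. -/
lemma integrableOn_of_isBounded {X : Type*} [MetricSpace X] [ProperSpace X]
    [MeasurableSpace X] [BorelSpace X] {μ : Measure X} [IsFiniteMeasureOnCompacts μ]
    {f : X → ℝ} (hf : Continuous f) {D : Set X} (hD : Bornology.IsBounded D) :
    IntegrableOn f D μ :=
  (hf.continuousOn.integrableOn_compact hD.isCompact_closure).mono_set subset_closure

/-- Lemma 3.1, formula (3.3): lower bound for `∫_D e^{2√τ x·ω} dx` in terms of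
the support function `h_D(ω)`, under an interior tangent ball hypothesis. -/
theorem lemma31_support
    (D : Set (EuclideanSpace ℝ (Fin 3))) (hDo : IsOpen D) (hDne : D.Nonempty)
    (hDb : Bornology.IsBounded D)
    (ω : EuclideanSpace ℝ (Fin 3)) (hω : ‖ω‖ = 1)
    (hD : ℝ) (hhD : hD = sSup ((fun x => ⟪x, ω⟫) '' D))
    (c : EuclideanSpace ℝ (Fin 3)) (ρ : ℝ) (hρ : 0 < ρ)
    (hball : ball c ρ ⊆ D) (htang : ⟪c, ω⟫ + ρ = hD) :
    ∃ μ₁ : ℝ, ∃ κ > 0, ∀ᶠ τ : ℝ in atTop,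
      κ ≤ τ ^ μ₁ * Real.exp (-2 * Real.sqrt τ * hD) *
        ∫ x in D, Real.exp (2 * Real.sqrt τ * ⟪x, ω⟫) := by
  set V : ℝ := volume.real (ball (0 : EuclideanSpace ℝ (Fin 3)) 1)
  have hV : 0 < V := ENNReal.toReal_pos (measure_ball_pos _ _ one_pos).ne' measure_ball_lt_top.ne
  refine ⟨3 / 2, Real.exp (-4) * V, by positivity, ?_⟩
  have hlarge : ∀ᶠ τ : ℝ in atTop, ρ⁻¹ ≤ √τ := Real.tendsto_sqrt_atTop.eventually_ge_atTop _
  filter_upwards [eventually_gt_atTop 0, hlarge] with τ hτ hτρ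
  have hr : 0 < √τ := Real.sqrt_pos.2 hτ
  have hs : (√τ)⁻¹ ≤ ρ := inv_le_of_inv_le₀ hρ hτρ
  set B := ball (c + (ρ - (√τ)⁻¹) • ω) (√τ)⁻¹
  have hBD : B ⊆ D := (ball_add_smul_subset_ball c ω hω hs).trans hball
  have hint : IntegrableOn (fun x => Real.exp (2 * √τ * ⟪x, ω⟫)) D :=
    integrableOn_of_isBounded (by fun_prop) hDb
  have hvol : volume.real B = (√τ)⁻¹ ^ 3 * V := by
    rw [measureReal_def, Measure.addHaar_ball volume _ (inv_pos.2 hr).le, ENNReal.toReal_mul,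
      ENNReal.toReal_ofReal (by positivity), finrank_euclideanSpace_fin, ← measureReal_def]
  have hpow : τ ^ (3 / 2 : ℝ) = √τ ^ 3 := by
    rw [Real.sqrt_eq_rpow, ← Real.rpow_natCast, ← Real.rpow_mul hτ.le]
    norm_num
  have hlower : Real.exp (2 * √τ * hD - 4) * ((√τ)⁻¹ ^ 3 * V) ≤
      ∫ x in D, Real.exp (2 * √τ * ⟪x, ω⟫) := by
    rw [← hvol]
    refine (setIntegral_ge_of_const_le_real measurableSet_ball measure_ball_lt_top.ne
      (fun x hx => ?_) (hint.mono_set hBD)).trans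
      (setIntegral_mono_set hint (ae_of_all _ fun x => (Real.exp_pos _).le) hBD.eventuallyLE)
    have h := mul_le_mul_of_nonneg_left (le_inner_of_mem_ball_add_smul hω hx)
      (by positivity : 0 ≤ 2 * √τ)
    rw [htang, mul_sub, show 2 * √τ * (2 * (√τ)⁻¹) = 4 by field_simp; norm_num] at h
    exact Real.exp_le_exp.2 h
  calc Real.exp (-4) * V
      = τ ^ (3 / 2 : ℝ) * Real.exp (-2 * √τ * hD) *
          (Real.exp (2 * √τ * hD - 4) * ((√τ)⁻¹ ^ 3 * V)) := by
        rw [hpow, show (-4 : ℝ) = -2 * √τ * hD + (2 * √τ * hD - 4) by ring, Real.exp_add]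
        field_simp
    _ ≤ _ := by gcongr
end

section
/- Let D ⊆ ℝ³ be a nonempty bounded open set and p ∈ ℝ³. Assume there exist c ∈ ℝ³ and ρ > 0 such that the open ball B_ρ(c) ⊆ D and |c−p| = d_D(p) + ρ. Then there exists μ₂ ∈ ℝ such that liminf_{τ→∞} τ^{μ₂} e^{2√τ d_D(p)} ∫_D e^{−2√τ |x−p|} dx > 0. -/
open MeasureTheory Filter Metric
open scoped Topology

/-- A ball tangent from inside to a larger ball `ball c ρ`, at the point of the latter
closest to `p`. -/
lemma exists_ball_subset_ball_dist_eq {E : Type*} [NormedAddCommGroup E] [NormedSpace ℝ E]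
    {p c : E} {d ρ s : ℝ} (hd : 0 ≤ d) (hs : 0 < s) (hsρ : s ≤ ρ) (hc : dist c p = d + ρ) :
    ∃ y : E, dist y p = d + s ∧ ball y s ⊆ ball c ρ := by
  have hpos : 0 < d + ρ := by linarith
  have hn : ‖c - p‖ = d + ρ := by rw [← dist_eq_norm, hc]
  refine ⟨AffineMap.lineMap p c ((d + s) / (d + ρ)), ?_, ball_subset_ball' ?_⟩
  · rw [dist_lineMap_left, dist_comm p c, hc, Real.norm_of_nonneg (by positivity)]
    field_simp
  · have h : 1 - (d + s) / (d + ρ) = (ρ - s) / (d + ρ) := by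
      field_simp
      ring
    rw [dist_lineMap_right, dist_comm p c, hc, h,
      Real.norm_of_nonneg (div_nonneg (by linarith) hpos.le), div_mul_cancel₀ _ hpos.ne']
    linarith

/-- The integral of `exp (-a |x - p|)` over a set is bounded below by the contribution of a
ball contained in it. -/
lemma measureReal_ball_mul_exp_le_setIntegral {E : Type*} [MetricSpace E] [ProperSpace E]
    [MeasurableSpace E] [BorelSpace E] (μ : Measure E) [IsFiniteMeasureOnCompacts μ]
    {D : Set E} (hD : Bornology.IsBounded D) {p y : E} {a r s : ℝ} (ha : 0 ≤ a)
    (hy : ball y s ⊆ D) (hr : dist y p + s ≤ r) :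
    μ.real (ball y s) * Real.exp (-a * r) ≤ ∫ x in D, Real.exp (-a * dist x p) ∂μ := by
  obtain ⟨R, hR⟩ := hD.subset_closedBall p
  have hint : IntegrableOn (fun x => Real.exp (-a * dist x p)) D μ := by
    refine IntegrableOn.mono_set ?_ hR
    exact (by fun_prop : Continuous fun x => Real.exp (-a * dist x p)).continuousOn
      |>.integrableOn_compact (isCompact_closedBall p R)
  calc μ.real (ball y s) * Real.exp (-a * r)
      = ∫ _ in ball y s, Real.exp (-a * r) ∂μ := by simp
    _ ≤ ∫ x in ball y s, Real.exp (-a * dist x p) ∂μ := by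
        refine setIntegral_mono_on (integrableOn_const measure_ball_lt_top.ne)
          (hint.mono_set hy) measurableSet_ball fun x hx => ?_
        have h1 : dist x p ≤ r := by
          have := dist_triangle x y p
          have := mem_ball.1 hx
          linarith
        exact Real.exp_le_exp.2 (mul_le_mul_of_nonpos_left h1 (by linarith))
    _ ≤ ∫ x in D, Real.exp (-a * dist x p) ∂μ :=
        setIntegral_mono_set hint (Eventually.of_forall fun _ => (Real.exp_pos _).le)
          hy.eventuallyLE

/-- Lemma 3.1, formula (3.4): lower bound for `∫_D e^{-2√τ |x-p|} dx` in terms of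
the distance `d_D(p)`, under an interior tangent ball hypothesis. -/
theorem lemma31_dist
    (D : Set (EuclideanSpace ℝ (Fin 3))) (hDo : IsOpen D) (hDne : D.Nonempty)
    (hDb : Bornology.IsBounded D)
    (p : EuclideanSpace ℝ (Fin 3))
    (dD : ℝ) (hdD : dD = Metric.infDist p D)
    (c : EuclideanSpace ℝ (Fin 3)) (ρ : ℝ) (hρ : 0 < ρ)
    (hball : ball c ρ ⊆ D) (htang : dist c p = dD + ρ) :
    ∃ μ₂ : ℝ, ∃ κ > 0, ∀ᶠ τ : ℝ in atTop,
      κ ≤ τ ^ μ₂ * Real.exp (2 * Real.sqrt τ * dD) *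
        ∫ x in D, Real.exp (-2 * Real.sqrt τ * dist x p) := by
  have hd : 0 ≤ dD := hdD ▸ infDist_nonneg
  set v := (volume : Measure (EuclideanSpace ℝ (Fin 3))).real (ball 0 1) with hv
  have hvpos : 0 < v := ENNReal.toReal_pos (measure_ball_pos _ _ one_pos).ne'
    measure_ball_lt_top.ne
  refine ⟨3 / 2, v * Real.exp (-4), by positivity, ?_⟩
  filter_upwards [Real.tendsto_sqrt_atTop.eventually_ge_atTop ρ⁻¹, eventually_gt_atTop 0]
    with τ hτρ hτ
  have ht : 0 < √τ := Real.sqrt_pos.2 hτ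
  obtain ⟨y, hyp, hyc⟩ := exists_ball_subset_ball_dist_eq hd (inv_pos.2 ht)
    (inv_le_of_inv_le₀ hρ hτρ) htang
  have key := measureReal_ball_mul_exp_le_setIntegral volume hDb (a := 2 * √τ)
    (by positivity) (hyc.trans hball) (r := dD + 2 * (√τ)⁻¹) (by linarith)
  have hvol : volume.real (ball y (√τ)⁻¹) = (√τ)⁻¹ ^ 3 * v := by
    rw [measureReal_def, Measure.addHaar_ball _ _ (inv_pos.2 ht).le, finrank_euclideanSpace_fin,
      ENNReal.toReal_mul, ENNReal.toReal_ofReal (by positivity), hv, measureReal_def]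
  rw [hvol] at key
  have hpow : τ ^ (3 / 2 : ℝ) = √τ ^ 3 := by
    rw [Real.sqrt_eq_rpow, ← Real.rpow_natCast, ← Real.rpow_mul hτ.le]
    norm_num
  have hexp : Real.exp (2 * √τ * dD) * Real.exp (-(2 * √τ) * (dD + 2 * (√τ)⁻¹))
      = Real.exp (-4) := by
    rw [← Real.exp_add]
    congr 1
    field_simp
    ring
  calc v * Real.exp (-4)
      = √τ ^ 3 * Real.exp (2 * √τ * dD) *
          ((√τ)⁻¹ ^ 3 * v * Real.exp (-(2 * √τ) * (dD + 2 * (√τ)⁻¹))) := by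
        rw [← hexp]
        field_simp
    _ ≤ τ ^ (3 / 2 : ℝ) * Real.exp (2 * √τ * dD) *
          ∫ x in D, Real.exp (-2 * √τ * dist x p) := by
        rw [hpow, neg_mul 2 (√τ)]
        gcongr
end

section
/- Let D ⊆ ℝ³ be a nonempty bounded open set and y ∈ ℝ³. Assume there exist c ∈ ℝ³ and ρ > 0 such that the open ball B_ρ(c) ⊆ D and |c−y| + ρ = R_D(y). Then there exists μ₃ ∈ ℝ such that liminf_{τ→∞} τ^{μ₃} e^{−2√τ R_D(y)} ∫_D e^{2√τ |x−y|} dx > 0. -/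
open MeasureTheory Filter Metric
open scoped Topology

/-- In a nontrivial real normed space, every vector can be prolonged by a unit vector in its own
direction. -/
lemma exists_unit_norm_add_smul {E : Type*} [NormedAddCommGroup E] [NormedSpace ℝ E]
    [Nontrivial E] (v : E) :
    ∃ e : E, ‖e‖ = 1 ∧ ∀ t : ℝ, 0 ≤ t → ‖v + t • e‖ = ‖v‖ + t := by
  rcases eq_or_ne v 0 with rfl | hv
  · obtain ⟨e, he⟩ := exists_norm_eq E zero_le_one
    exact ⟨e, he, fun t ht => by simp [norm_smul, he, abs_of_nonneg ht]⟩
  · have he : ‖(‖v‖⁻¹ : ℝ) • v‖ = 1 := norm_smul_inv_norm (𝕜 := ℝ) hv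
    refine ⟨(‖v‖⁻¹ : ℝ) • v, he, fun t ht => ?_⟩
    have hray : SameRay ℝ v (t • (‖v‖⁻¹ : ℝ) • v) :=
      ((SameRay.refl v).nonneg_smul_right (inv_nonneg.2 (norm_nonneg v))).nonneg_smul_right ht
    rw [hray.norm_add, norm_smul t, he, Real.norm_of_nonneg ht, mul_one]

/-- A ball contains a ball of any smaller radius `r` whose points are at distance at least
`dist c y + ρ - 2 * r` from `y`. -/
lemma exists_ball_subset_far {E : Type*} [NormedAddCommGroup E] [NormedSpace ℝ E]
    [Nontrivial E] (c y : E) {ρ r : ℝ} (hr : r ≤ ρ) :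
    ∃ z : E, ball z r ⊆ ball c ρ ∧ ∀ x ∈ ball z r, dist c y + ρ - 2 * r ≤ dist x y := by
  obtain ⟨e, he, hadd⟩ := exists_unit_norm_add_smul (c - y)
  have hzc : dist (c + (ρ - r) • e) c = ρ - r := by
    simp [dist_eq_norm, norm_smul, he, abs_of_nonneg (sub_nonneg.2 hr)]
  have hzy : dist (c + (ρ - r) • e) y = dist c y + (ρ - r) := by
    rw [dist_eq_norm, dist_eq_norm, ← hadd _ (sub_nonneg.2 hr)]
    congr 1
    abel
  refine ⟨c + (ρ - r) • e, ball_subset_ball' (by rw [hzc]; linarith), fun x hx => ?_⟩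
  have h := dist_triangle_left (c + (ρ - r) • e) y x
  rw [mem_ball] at hx
  linarith

/-- Lemma 3.1, formula (3.5): lower bound for `∫_D e^{2√τ |x-y|} dx` in terms of
the circumscribing radius `R_D(y)`, under an interior tangent ball hypothesis. -/
theorem lemma31_radius
    (D : Set (EuclideanSpace ℝ (Fin 3))) (hDo : IsOpen D) (hDne : D.Nonempty)
    (hDb : Bornology.IsBounded D)
    (y : EuclideanSpace ℝ (Fin 3))
    (RD : ℝ) (hRD : RD = sSup ((fun x => dist x y) '' D))
    (c : EuclideanSpace ℝ (Fin 3)) (ρ : ℝ) (hρ : 0 < ρ)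
    (hball : ball c ρ ⊆ D) (htang : dist c y + ρ = RD) :
    ∃ μ₃ : ℝ, ∃ κ > 0, ∀ᶠ τ : ℝ in atTop,
      κ ≤ τ ^ μ₃ * Real.exp (-2 * Real.sqrt τ * RD) *
        ∫ x in D, Real.exp (2 * Real.sqrt τ * dist x y) := by
  have hV : 0 < volume.real (ball (0 : EuclideanSpace ℝ (Fin 3)) 1) :=
    ENNReal.toReal_pos (measure_ball_pos volume _ one_pos).ne' measure_ball_lt_top.ne
  refine ⟨3 / 2, Real.exp (-4) * volume.real (ball (0 : EuclideanSpace ℝ (Fin 3)) 1),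
    mul_pos (Real.exp_pos _) hV, ?_⟩
  filter_upwards [Real.tendsto_sqrt_atTop.eventually_ge_atTop ρ⁻¹, eventually_gt_atTop 0]
    with τ hτρ hτ
  have hs : 0 < √τ := Real.sqrt_pos.2 hτ
  obtain ⟨z, hzc, hzy⟩ := exists_ball_subset_far c y (inv_le_of_inv_le₀ hρ hτρ)
  have hint : IntegrableOn (fun x => Real.exp (2 * √τ * dist x y)) D :=
    ((Continuous.continuousOn (by fun_prop)).integrableOn_compact
      hDb.isCompact_closure).mono_set subset_closure
  have hvol : volume.real (ball z (√τ)⁻¹)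
      = ((√τ)⁻¹) ^ 3 * volume.real (ball (0 : EuclideanSpace ℝ (Fin 3)) 1) := by
    rw [measureReal_def, Measure.addHaar_ball volume z (inv_nonneg.2 hs.le),
      finrank_euclideanSpace_fin, ENNReal.toReal_mul, ENNReal.toReal_ofReal (by positivity),
      measureReal_def]
  have hlow : Real.exp (2 * √τ * RD - 4) * volume.real (ball z (√τ)⁻¹)
      ≤ ∫ x in D, Real.exp (2 * √τ * dist x y) := by
    refine (setIntegral_ge_of_const_le_real measurableSet_ball measure_ball_lt_top.ne
      (fun x hx => Real.exp_le_exp.2 ?_) (hint.mono_set (hzc.trans hball))).trans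
      (setIntegral_mono_set hint (ae_of_all _ fun x => (Real.exp_pos _).le)
        (hzc.trans hball).eventuallyLE)
    have h := mul_le_mul_of_nonneg_left (hzy x hx) (by positivity : 0 ≤ 2 * √τ)
    rw [htang] at h
    have h1 : √τ * (√τ)⁻¹ = 1 := mul_inv_cancel₀ hs.ne'
    linarith
  have hpow : τ ^ (3 / 2 : ℝ) = √τ ^ 3 := by
    rw [Real.sqrt_eq_rpow, ← Real.rpow_natCast, ← Real.rpow_mul hτ.le]
    norm_num
  have hexp : Real.exp (-4) = Real.exp (-2 * √τ * RD) * Real.exp (2 * √τ * RD - 4) := by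
    rw [← Real.exp_add]
    ring_nf
  refine le_trans (le_of_eq ?_) (mul_le_mul_of_nonneg_left hlow (by positivity))
  rw [hvol, hpow, hexp]
  field_simp
end

section
/- Let K, Γ be nonempty compact subsets of ℝ³ with d₀ := inf{|x−y| : x ∈ K, y ∈ Γ} > 0, let μ be a finite Borel measure on ℝ³ with μ(ℝ³ ∖ Γ) = 0, let C' > 0, and for each τ ≥ 1 let ψ_τ : ℝ³ → ℝ be measurable with |ψ_τ(y)| ≤ C' for all y ∈ Γ. Define G_τ(x) = (1/(2π)) ∫_Γ ψ_τ(y) (e^{−√τ |x−y|}/|x−y|) (√τ + 1/|x−y|) ((x−y)/|x−y|) dμ(y) for x ∈ K. Then limsup_{τ→∞} τ^{−1} e^{2√τ d₀} ∫_K |G_τ(x)|² dx < ∞. -/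
open MeasureTheory Filter Metric
open scoped Topology

/-- Pointwise bound for the gradient of the kernel `e^{-s|z|}/|z|` with `|z| ≥ d` and `s ≥ 1`. -/
theorem norm_yukawa_gradient_le {E : Type*} [NormedAddCommGroup E] [NormedSpace ℝ E]
    {z : E} {a C d s : ℝ} (hd : 0 < d) (hz : d ≤ ‖z‖) (hs : 1 ≤ s) (ha : |a| ≤ C) :
    ‖(a * (Real.exp (-s * ‖z‖) / ‖z‖) * (s + 1 / ‖z‖) * ‖z‖⁻¹) • z‖ ≤
      C * ((1 + 1 / d) / d) * (s * Real.exp (-(s * d))) := by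
  have hz0 : 0 < ‖z‖ := hd.trans_le hz
  have hC : 0 ≤ C := (abs_nonneg a).trans ha
  have hexp : Real.exp (-s * ‖z‖) ≤ Real.exp (-(s * d)) := by
    rw [neg_mul]
    gcongr
  have hsum : s + 1 / ‖z‖ ≤ s * (1 + 1 / d) := by
    have h₁ : 1 / ‖z‖ ≤ 1 / d := by gcongr
    have h₂ : 1 / d ≤ s * (1 / d) := le_mul_of_one_le_left (by positivity) hs
    linarith
  calc
    _ = |a| * (Real.exp (-s * ‖z‖) / ‖z‖) * (s + 1 / ‖z‖) := by
      have h : 0 ≤ s + 1 / ‖z‖ := by positivity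
      simp only [norm_smul, norm_mul, norm_div, norm_inv, Real.norm_eq_abs,
        Real.abs_exp, abs_of_nonneg h, abs_norm]
      field_simp
    _ ≤ C * (Real.exp (-(s * d)) / d) * (s * (1 + 1 / d)) := by gcongr
    _ = _ := by ring

/-- Upper bound (2.14) of Lemma 2.1 (with `λ₁ = -1`) in single-layer-potential
form: `limsup_{τ→∞} τ⁻¹ e^{2√τ d₀} ∫_K |G_τ|² dx < ∞`. -/
theorem lemma21_upper
    (K Γ : Set (EuclideanSpace ℝ (Fin 3)))
    (hKc : IsCompact K) (hKne : K.Nonempty)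
    (hΓc : IsCompact Γ) (hΓne : Γ.Nonempty)
    (d₀ : ℝ)
    (hd₀ : d₀ = sInf {r : ℝ | ∃ x ∈ K, ∃ y ∈ Γ, r = dist x y})
    (hd₀pos : 0 < d₀)
    (μ : Measure (EuclideanSpace ℝ (Fin 3))) [IsFiniteMeasure μ]
    (hμ : μ Γᶜ = 0)
    (C' : ℝ) (hC' : 0 < C')
    (ψ : ℝ → EuclideanSpace ℝ (Fin 3) → ℝ)
    (hψm : ∀ τ, Measurable (ψ τ))
    (hψb : ∀ τ ≥ (1 : ℝ), ∀ y ∈ Γ, |ψ τ y| ≤ C')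
    (G : ℝ → EuclideanSpace ℝ (Fin 3) → EuclideanSpace ℝ (Fin 3))
    (hG : ∀ τ x, G τ x = (1 / (2 * Real.pi)) •
      ∫ y in Γ, (ψ τ y * (Real.exp (-Real.sqrt τ * ‖x - y‖) / ‖x - y‖) *
        (Real.sqrt τ + 1 / ‖x - y‖) * ‖x - y‖⁻¹) • (x - y) ∂μ) :
    ∃ Cb : ℝ, ∀ᶠ τ : ℝ in atTop,
      τ⁻¹ * Real.exp (2 * Real.sqrt τ * d₀) * ∫ x in K, ‖G τ x‖ ^ 2 ≤ Cb := by
  have hdist : ∀ x ∈ K, ∀ y ∈ Γ, d₀ ≤ ‖x - y‖ := by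
    intro x hx y hy
    rw [hd₀, ← dist_eq_norm]
    exact csInf_le ⟨0, by rintro _ ⟨x, -, y, -, rfl⟩; exact dist_nonneg⟩ ⟨x, hx, y, hy, rfl⟩
  set A : ℝ := 1 / (2 * Real.pi) * (C' * ((1 + 1 / d₀) / d₀) * μ.real Γ) with hA
  refine ⟨A ^ 2 * volume.real K, ?_⟩
  filter_upwards [eventually_ge_atTop 1] with τ hτ
  have hs : 1 ≤ Real.sqrt τ := Real.one_le_sqrt.2 hτ
  have hGx : ∀ x ∈ K, ‖G τ x‖ ≤ A * (Real.sqrt τ * Real.exp (-(Real.sqrt τ * d₀))) := by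
    intro x hx
    have hint := norm_setIntegral_le_of_norm_le_const (measure_lt_top μ Γ) fun y hy ↦
      norm_yukawa_gradient_le hd₀pos (hdist x hx y hy) hs (hψb τ hτ y hy)
    rw [hG, norm_smul, Real.norm_of_nonneg (by positivity)]
    calc
      _ ≤ _ := mul_le_mul_of_nonneg_left hint (by positivity)
      _ = _ := by rw [hA]; ring
  have hK : ∫ x in K, ‖G τ x‖ ^ 2 ≤
      (A * (Real.sqrt τ * Real.exp (-(Real.sqrt τ * d₀)))) ^ 2 * volume.real K := by
    refine (Real.le_norm_self _).trans (norm_setIntegral_le_of_norm_le_const hKc.measure_lt_top ?_)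
    intro x hx
    rw [Real.norm_of_nonneg (by positivity)]
    gcongr
    exact hGx x hx
  have hexp : Real.exp (2 * Real.sqrt τ * d₀) * Real.exp (-(Real.sqrt τ * d₀)) ^ 2 = 1 := by
    rw [← Real.exp_nat_mul, ← Real.exp_add, Real.exp_eq_one_iff]
    push_cast
    ring
  calc
    _ ≤ τ⁻¹ * Real.exp (2 * Real.sqrt τ * d₀) *
        ((A * (Real.sqrt τ * Real.exp (-(Real.sqrt τ * d₀)))) ^ 2 * volume.real K) :=
      mul_le_mul_of_nonneg_left hK (by positivity)
    _ = τ⁻¹ * Real.sqrt τ ^ 2 *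
        (Real.exp (2 * Real.sqrt τ * d₀) * Real.exp (-(Real.sqrt τ * d₀)) ^ 2) *
        (A ^ 2 * volume.real K) := by ring
    _ = A ^ 2 * volume.real K := by
      rw [hexp, Real.sq_sqrt (by positivity), inv_mul_cancel₀ (by positivity), one_mul, one_mul]
end
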